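/- Let 0 < α ≤ 1, let g be analytic on 𝔻 and continuous on the closed disc, and let K be an inner function (a bounded analytic function on 𝔻 whose radial limits have modulus 1 at almost every point of 𝕋) such that h := g/K extends to a bounded analytic function on 𝔻. Then for every z = re^{iθ} ∈ 𝔻, |h'(z)| ≤ (1/2π) ∫_{−π}^{π} |g(e^{i(t+θ)}) − g(e^{iθ})| / (1 − 2r cos t + r²) dt. In particular, if |g(z)−g(w)| = o(|z−w|^α), then |h'(z)| = o((1−|z|)^{α−1}) as |z| → 1⁻, uniformly over all inner divisors K of g. -/

import Mathlib

open Complex MeasureTheory Set Metric Filter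
open scoped ENNReal Classical

noncomputable section

/-- The open unit disc in `ℂ`. -/
def uDisc : Set ℂ := Metric.ball 0 1

/-- The unit circle in `ℂ`. -/
def uCircle : Set ℂ := Metric.sphere (0 : ℂ) 1

/-- `f` is analytic on the open unit disc and continuous on the closed unit disc. -/
def IsDiscReg (f : ℂ → ℂ) : Prop :=
  DifferentiableOn ℂ f uDisc ∧ ContinuousOn f (Metric.closedBall 0 1)

/-- The little-o Lipschitz condition of order `α` on the closed unit disc:
`|f z - f w| = o(|z-w|^α)` as `|z - w| → 0`. -/
def LittleLip (α : ℝ) (f : ℂ → ℂ) : Prop :=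
  ∀ ε > 0, ∃ δ > 0, ∀ z ∈ Metric.closedBall (0 : ℂ) 1, ∀ w ∈ Metric.closedBall (0 : ℂ) 1,
    ‖z - w‖ < δ → ‖f z - f w‖ ≤ ε * ‖z - w‖ ^ α

/-- Membership in `lip_α`. -/
def MemLip (α : ℝ) (f : ℂ → ℂ) : Prop := IsDiscReg f ∧ LittleLip α f

/-- The Dirichlet integral `D(f) = ∫_𝔻 |f'|² dA` with respect to the normalized
area measure `dA = (1/π)·(Lebesgue)`. -/
def dirInt (f : ℂ → ℂ) : ℝ := (1 / Real.pi) * ∫ z in uDisc, ‖deriv f z‖ ^ 2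

/-- Membership in the Dirichlet space `𝒟`. -/
def MemDir (f : ℂ → ℂ) : Prop :=
  DifferentiableOn ℂ f uDisc ∧ IntegrableOn (fun z => ‖deriv f z‖ ^ 2) uDisc

/-- Sup norm over the unit disc. -/
def supNorm (f : ℂ → ℂ) : ℝ := sSup ((fun z => ‖f z‖) '' uDisc)

/-- The `lip_α` norm `‖f‖_α = ‖f‖_∞ + sup_{z∈𝔻} (1-|z|)^{1-α}|f'(z)|`. -/
def lipNorm (α : ℝ) (f : ℂ → ℂ) : ℝ :=
  supNorm f + sSup ((fun z => (1 - ‖z‖) ^ (1 - α) * ‖deriv f z‖) '' uDisc)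

/-- The `𝒜_α` norm `‖f‖_{𝒜_α} = ‖f‖_α + D(f)^{1/2}`. -/
def ANorm (α : ℝ) (f : ℂ → ℂ) : ℝ := lipNorm α f + Real.sqrt (dirInt f)

/-- Membership in `𝒜_α = 𝒟 ∩ lip_α`. -/
def MemA (α : ℝ) (f : ℂ → ℂ) : Prop := MemDir f ∧ MemLip α f

/-- A closed ideal of the Banach algebra `𝒜_α`, encoded as a set of functions `ℂ → ℂ`
(two functions agreeing on the closed disc represent the same element of `𝒜_α`). -/
structure IsClosedIdeal (α : ℝ) (J : Set (ℂ → ℂ)) : Prop where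
  mem_A : ∀ f ∈ J, MemA α f
  zero_mem : (0 : ℂ → ℂ) ∈ J
  add_mem : ∀ f ∈ J, ∀ g ∈ J, f + g ∈ J
  smul_mem : ∀ (c : ℂ), ∀ f ∈ J, c • f ∈ J
  mul_mem : ∀ f ∈ J, ∀ g : ℂ → ℂ, MemA α g → f * g ∈ J
  ext_mem : ∀ f ∈ J, ∀ g : ℂ → ℂ, MemA α g →
    (∀ z ∈ Metric.closedBall (0 : ℂ) 1, g z = f z) → g ∈ J
  closed : ∀ (F : ℕ → ℂ → ℂ) (f : ℂ → ℂ), (∀ n, F n ∈ J) → MemA α f →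
    Tendsto (fun n => ANorm α (F n - f)) atTop (nhds 0) → f ∈ J

/-- The boundary zero set `E_f = {ξ ∈ 𝕋 : f ξ = 0}`. -/
def bZeros (f : ℂ → ℂ) : Set ℂ := {ξ | ξ ∈ uCircle ∧ f ξ = 0}

/-- An inner function: bounded analytic on `𝔻` with radial limits of modulus `1`
at almost every point of `𝕋`. -/
def IsInner (U : ℂ → ℂ) : Prop :=
  DifferentiableOn ℂ U uDisc ∧ (∀ z ∈ uDisc, ‖U z‖ ≤ 1) ∧
    ∀ᵐ θ : ℝ, Tendsto (fun r : ℝ => ‖U ((r : ℂ) * Complex.exp ((θ : ℂ) * Complex.I))‖)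
      (nhdsWithin 1 (Set.Iio 1)) (nhds 1)

/-- The Schwarz/Herglotz kernel `(e^{iθ}+z)/(e^{iθ}-z)`. -/
def circleKernel (z : ℂ) (θ : ℝ) : ℂ :=
  (Complex.exp ((θ : ℂ) * Complex.I) + z) / (Complex.exp ((θ : ℂ) * Complex.I) - z)

/-- `f` is an outer function. -/
def IsOuter (f : ℂ → ℂ) : Prop :=
  IsDiscReg f ∧ (∃ z ∈ uDisc, f z ≠ 0) ∧
    ∀ z ∈ uDisc, f z = Complex.exp ((1 / (2 * (Real.pi : ℂ))) *
      ∫ θ in (0:ℝ)..(2 * Real.pi),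
        circleKernel z θ * (Real.log ‖f (Complex.exp ((θ : ℂ) * Complex.I))‖ : ℂ))

/-- The outer power `f^ρ`, the outer function with boundary modulus `|f|^ρ`. -/
def outerPow (f : ℂ → ℂ) (ρ : ℝ) (z : ℂ) : ℂ :=
  Complex.exp (((ρ : ℂ) / (2 * (Real.pi : ℂ))) *
    ∫ θ in (0:ℝ)..(2 * Real.pi),
      circleKernel z θ * (Real.log ‖f (Complex.exp ((θ : ℂ) * Complex.I))‖ : ℂ))

/-- The set of angles in `[0, 2π)` whose corresponding point of the circle lies in `A`. -/
def angSet (A : Set ℂ) : Set ℝ :=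
  {θ | θ ∈ Set.Ico (0 : ℝ) (2 * Real.pi) ∧ Complex.exp ((θ : ℂ) * Complex.I) ∈ A}

/-- The outer factor `f_Γ` associated with a boundary set `Γ ⊆ 𝕋`. -/
def outerPart (f : ℂ → ℂ) (Γ : Set ℂ) (z : ℂ) : ℂ :=
  Complex.exp ((1 / (2 * (Real.pi : ℂ))) *
    ∫ θ in angSet Γ, circleKernel z θ * (Real.log ‖f (Complex.exp ((θ : ℂ) * Complex.I))‖ : ℂ))

/-- `𝕋 \ E_f`, the set of boundary points where `f` does not vanish. -/
def offZeros (f : ℂ → ℂ) : Set ℂ := {ξ | ξ ∈ uCircle ∧ f ξ ≠ 0}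

/-- `γ` is a component arc (connected component) of `𝕋 \ E_f`. -/
def IsCompArc (f : ℂ → ℂ) (γ : Set ℂ) : Prop :=
  ∃ x ∈ offZeros f, γ = connectedComponentIn (offZeros f) x

/-- `Γ` is a union of component arcs of `𝕋 \ E_f`. -/
def IsArcUnion (f : ℂ → ℂ) (Γ : Set ℂ) : Prop :=
  Γ ⊆ offZeros f ∧ ∀ x ∈ Γ, connectedComponentIn (offZeros f) x ⊆ Γ

/-- The sector `Δ_γ = {z ∈ 𝔻 : z/|z| ∈ γ}`. -/
def discSector (γ : Set ℂ) : Set ℂ := {z | z ∈ uDisc ∧ ((‖z‖ : ℂ))⁻¹ * z ∈ γ}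

/-- Lower integral of `g` over `S` with respect to the normalized area measure
`dA = (1/π)·(Lebesgue)`. -/
def nlint (S : Set ℂ) (g : ℂ → ℝ) : ℝ≥0∞ :=
  ENNReal.ofReal (1 / Real.pi) * ∫⁻ z in S, ENNReal.ofReal (g z)

/-- `d(z) = min(|z-a|, |z-b|)`, distance to the endpoints of the arc `γ = (a,b)`. -/
def dd (a b z : ℂ) : ℝ := min ‖z - a‖ ‖z - b‖

/-- `Λ_γ`: equals `Γ` if `γ ⊄ Γ`, and `𝕋 \ Γ` if `γ ⊆ Γ`. -/
def lamSet (Γ γ : Set ℂ) : Set ℂ := if γ ⊆ Γ then uCircle \ Γ else Γ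

/-- The function `a_γ(z) = (1/2π)∫_{Λ_γ} (−log|f(e^{iθ})|)/|e^{iθ}−z|² dθ`. -/
def aFun (f : ℂ → ℂ) (Γ γ : Set ℂ) (z : ℂ) : ℝ :=
  (1 / (2 * Real.pi)) * ∫ θ in angSet (lamSet Γ γ),
    (-(Real.log ‖f (Complex.exp ((θ : ℂ) * Complex.I))‖)) /
      ‖Complex.exp ((θ : ℂ) * Complex.I) - z‖ ^ 2

/-- `Δ_γ¹ = {z ∈ Δ_γ : d(z) < 2(1−|z|)}`. -/
def sector1 (a b : ℂ) (γ : Set ℂ) : Set ℂ :=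
  {z | z ∈ discSector γ ∧ dd a b z < 2 * (1 - ‖z‖)}

/-- `Δ_γ² = {z ∈ Δ_γ : d(z) ≥ 2(1−|z|)}`. -/
def sector2 (a b : ℂ) (γ : Set ℂ) : Set ℂ :=
  {z | z ∈ discSector γ ∧ 2 * (1 - ‖z‖) ≤ dd a b z}

/-- `Δ_γ²¹ = {z ∈ Δ_γ² : a_γ(z) ≤ 8|log d(z)|/d(z)}`. -/
def sector21 (f : ℂ → ℂ) (Γ γ : Set ℂ) (a b : ℂ) : Set ℂ :=
  {z | z ∈ sector2 a b γ ∧ aFun f Γ γ z ≤ 8 * |Real.log (dd a b z)| / dd a b z}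

/-- `Δ_γ²² = {z ∈ Δ_γ² : 8|log d(z)|/d(z) < a_γ(z) < 8|log d(z)|/(1−|z|)}`. -/
def sector22 (f : ℂ → ℂ) (Γ γ : Set ℂ) (a b : ℂ) : Set ℂ :=
  {z | z ∈ sector2 a b γ ∧ 8 * |Real.log (dd a b z)| / dd a b z < aFun f Γ γ z ∧
    aFun f Γ γ z < 8 * |Real.log (dd a b z)| / (1 - ‖z‖)}

/-- `Δ_γ²³ = {z ∈ Δ_γ² : a_γ(z) ≥ 8|log d(z)|/(1−|z|)}`. -/
def sector23 (f : ℂ → ℂ) (Γ γ : Set ℂ) (a b : ℂ) : Set ℂ :=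
  {z | z ∈ sector2 a b γ ∧ 8 * |Real.log (dd a b z)| / (1 - ‖z‖) ≤ aFun f Γ γ z}

/-- `μ_z = 1 − 8|log d(z)|/a_γ(z)`. -/
def muOf (f : ℂ → ℂ) (Γ γ : Set ℂ) (a b : ℂ) (z : ℂ) : ℝ :=
  1 - 8 * |Real.log (dd a b z)| / aFun f Γ γ z

/-- The tail union `Γ_m = ⋃_{p ≥ m} γ_p`. -/
def tailUnion (γ : ℕ → Set ℂ) (m : ℕ) : Set ℂ := ⋃ p ∈ Set.Ici m, γ p

end

open scoped Topology ComplexConjugate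

/-- The Cauchy kernel `(ζ - z)⁻²` on a circle annihilates conjugates of analytic functions. -/
lemma circleIntegral_sub_sq_inv_mul_conj_eq_zero {U : Set ℂ} {f : ℂ → ℂ} {R : ℝ} {z : ℂ}
    (hU : IsOpen U) (hRU : closedBall 0 R ⊆ U) (hf : DifferentiableOn ℂ f U)
    (hz : z ∈ ball (0 : ℂ) R) :
    (∮ ζ in C(0, R), ((ζ - z) ^ 2)⁻¹ • conj (f ζ)) = 0 := by
  rw [mem_ball_zero_iff] at hz
  have hR : 0 < R := (norm_nonneg z).trans_lt hz
  have hne : ∀ ζ ∈ closedBall (0 : ℂ) R, (R : ℂ) ^ 2 - conj z * ζ ≠ 0 := by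
    intro ζ hζ h0
    rw [mem_closedBall_zero_iff] at hζ
    have h1 : ‖(R : ℂ) ^ 2‖ = ‖conj z * ζ‖ := by rw [sub_eq_zero.mp h0]
    rw [norm_mul, norm_pow, RCLike.norm_conj, norm_real, Real.norm_of_nonneg hR.le] at h1
    nlinarith [mul_le_mul_of_nonneg_left hζ (norm_nonneg z)]
  have hd : ∀ ζ ∈ closedBall (0 : ℂ) R,
      DifferentiableAt ℂ (fun ζ => (R : ℂ) ^ 2 / ((R : ℂ) ^ 2 - conj z * ζ) ^ 2 * f ζ) ζ := by
    intro ζ hζ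
    have hfζ : DifferentiableAt ℂ f ζ := hf.differentiableAt (hU.mem_nhds (hRU hζ))
    refine DifferentiableAt.mul (DifferentiableAt.div (by fun_prop) (by fun_prop) ?_) hfζ
    exact pow_ne_zero _ (hne ζ hζ)
  have key : (∮ ζ in C(0, R), (R : ℂ) ^ 2 / ((R : ℂ) ^ 2 - conj z * ζ) ^ 2 * f ζ) = 0 :=
    circleIntegral_eq_zero_of_differentiable_on_off_countable hR.le countable_empty
      (fun ζ hζ => (hd ζ hζ).continuousAt.continuousWithinAt)
      (fun ζ hζ => hd ζ (ball_subset_closedBall hζ.1))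
  have hpt : ∀ s : ℝ, deriv (circleMap 0 R) s •
      (((circleMap 0 R s - z) ^ 2)⁻¹ • conj (f (circleMap 0 R s))) =
      conj (-(deriv (circleMap 0 R) s • ((R : ℂ) ^ 2 /
        ((R : ℂ) ^ 2 - conj z * circleMap 0 R s) ^ 2 * f (circleMap 0 R s)))) := by
    intro s
    set ζ := circleMap 0 R s with hζ
    have hn : ‖ζ‖ = R := by simp [hζ, abs_of_pos hR]
    have hmul : (R : ℂ) ^ 2 = ζ * conj ζ := by rw [mul_conj', hn]
    have hζ0 : ζ ≠ 0 := by
      rw [← norm_pos_iff, hn]; exact hR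
    have hζz : ζ - z ≠ 0 := by
      intro h0
      rw [sub_eq_zero.mp h0] at hn
      exact hz.ne hn
    have hcζ : conj ζ ≠ 0 := (map_ne_zero _).mpr hζ0
    simp only [deriv_circleMap, ← hζ, smul_eq_mul]
    simp only [map_neg, map_mul, map_div₀, map_pow, map_sub, conj_I, conj_conj, conj_ofReal]
    rw [hmul]
    have h2 : ζ * conj ζ - z * conj ζ = conj ζ * (ζ - z) := by ring
    rw [h2]
    field_simp
  rw [circleIntegral]
  simp_rw [hpt]
  rw [intervalIntegral.intervalIntegral_conj, intervalIntegral.integral_neg]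
  rw [circleIntegral] at key
  rw [key]
  simp

/-- Cauchy estimate for the derivative of `h` on a circle of radius `R < 1`, for a factorization `g = K h`. -/
lemma norm_deriv_le_integral_of_factorization {g K h : ℂ → ℂ} {B R : ℝ} {z c : ℂ}
    (hK : DifferentiableOn ℂ K uDisc) (hK1 : ∀ w ∈ uDisc, ‖K w‖ ≤ 1)
    (hh : DifferentiableOn ℂ h uDisc) (hB : ∀ w ∈ uDisc, ‖h w‖ ≤ B)
    (hg : ContinuousOn g uDisc) (hfac : ∀ w ∈ uDisc, g w = K w * h w)
    (hz : ‖z‖ < R) (hR1 : R < 1) :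
    ‖deriv h z‖ ≤ (1 / (2 * Real.pi)) * ∫ s in (0 : ℝ)..2 * Real.pi,
      R / ‖circleMap 0 R s - z‖ ^ 2 *
        (‖g (circleMap 0 R s) - c‖ + B * (1 - ‖K (circleMap 0 R s)‖ ^ 2)) := by
  have hR : 0 < R := (norm_nonneg z).trans_lt hz
  have hsub : closedBall (0 : ℂ) R ⊆ uDisc := closedBall_subset_ball hR1
  have hmem : ∀ s, circleMap 0 R s ∈ uDisc := fun s =>
    hsub (circleMap_mem_closedBall 0 hR.le s)
  have hzb : z ∈ ball (0 : ℂ) R := by simpa using hz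
  have hzs : ∀ ζ ∈ sphere (0 : ℂ) R, ((ζ - z) ^ 2) ≠ 0 := by
    intro ζ hζ h0
    have h1 := sub_eq_zero.mp (pow_eq_zero_iff two_ne_zero |>.mp h0)
    rw [h1, mem_sphere_zero_iff_norm] at hζ
    exact hz.ne hζ
  have hker : ContinuousOn (fun ζ => ((ζ - z) ^ 2)⁻¹) (sphere (0 : ℂ) R) :=
    ContinuousOn.inv₀ (by fun_prop) hzs
  have hss : sphere (0 : ℂ) R ⊆ uDisc := sphere_subset_closedBall.trans hsub
  have hhc : ContinuousOn h (sphere (0 : ℂ) R) := hh.continuousOn.mono hss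
  have hKc : ContinuousOn K (sphere (0 : ℂ) R) := hK.continuousOn.mono hss
  have hcauchy := two_pi_I_inv_smul_circleIntegral_sub_sq_inv_smul_of_differentiable
    isOpen_ball hsub hh hzb
  have hzero := circleIntegral_sub_sq_inv_mul_conj_eq_zero isOpen_ball hsub hK hzb
  have hconjK : ContinuousOn (fun ζ => conj (K ζ)) (sphere (0 : ℂ) R) :=
    continuous_conj.comp_continuousOn hKc
  have hrep : deriv h z = (2 * Real.pi * I : ℂ)⁻¹ •
      ∮ ζ in C(0, R), ((ζ - z) ^ 2)⁻¹ • (h ζ - c * conj (K ζ)) := by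
    have h1 : ∀ ζ : ℂ, ((ζ - z) ^ 2)⁻¹ • (h ζ - c * conj (K ζ)) =
        ((ζ - z) ^ 2)⁻¹ • h ζ - c • (((ζ - z) ^ 2)⁻¹ • conj (K ζ)) := by
      intro ζ
      simp only [smul_eq_mul]
      ring
    simp_rw [h1]
    rw [circleIntegral.integral_sub, circleIntegral.integral_smul, hzero, smul_zero, sub_zero,
      hcauchy]
    · exact (hker.smul hhc).circleIntegrable hR.le
    · exact ((hker.smul hconjK).const_smul c).circleIntegrable hR.le
  have hpi := Real.pi_pos
  rw [hrep, norm_smul, norm_inv, norm_mul, norm_mul, norm_I, norm_real, mul_one,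
    Real.norm_of_nonneg hpi.le, Complex.norm_ofNat, one_div]
  refine mul_le_mul_of_nonneg_left ?_ (by positivity)
  rw [circleIntegral]
  refine intervalIntegral.norm_integral_le_of_norm_le (by positivity) (.of_forall fun s _ => ?_) ?_
  · have hn : ‖circleMap 0 R s‖ = R := by simp [abs_of_pos hR]
    set ζ := circleMap 0 R s with hζ
    have hζm : ζ ∈ uDisc := hmem s
    rw [deriv_circleMap, ← hζ, norm_smul, norm_smul, norm_mul, hn, norm_I, mul_one, norm_inv,
      norm_pow, ← mul_assoc, ← div_eq_mul_inv]
    refine mul_le_mul_of_nonneg_left ?_ (by positivity)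
    have hK' := hK1 ζ hζm
    have h1 : h ζ - c * conj (K ζ) =
        (g ζ - c) * conj (K ζ) + h ζ * ((1 - ‖K ζ‖ ^ 2 : ℝ) : ℂ) := by
      push_cast
      rw [← mul_conj', hfac ζ hζm]
      ring
    have h2 : 0 ≤ 1 - ‖K ζ‖ ^ 2 := by nlinarith [norm_nonneg (K ζ)]
    rw [h1]
    refine (norm_add_le _ _).trans (add_le_add ?_ ?_)
    · rw [norm_mul, RCLike.norm_conj]
      exact mul_le_of_le_one_right (norm_nonneg _) hK'
    · rw [norm_mul, norm_real, Real.norm_of_nonneg h2]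
      exact mul_le_mul_of_nonneg_right (hB ζ hζm) h2
  · refine Continuous.intervalIntegrable ?_ _ _
    have hcm : Continuous (circleMap 0 R) := continuous_circleMap 0 R
    have hgc : Continuous fun s => g (circleMap 0 R s) := hg.comp_continuous hcm hmem
    have hKc' : Continuous fun s => K (circleMap 0 R s) :=
      hK.continuousOn.comp_continuous hcm hmem
    refine Continuous.mul (Continuous.div (by fun_prop) (by fun_prop) fun s => ?_)
      ((hgc.sub continuous_const).norm.add
          (continuous_const.mul (continuous_const.sub (hKc'.norm.pow 2))))
    rw [← norm_pow]
    exact norm_ne_zero_iff.mpr (hzs _ (circleMap_mem_sphere 0 hR.le s))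

/-- The boundary form of the Cauchy estimate for the quotient of `g` by an inner function. -/
lemma norm_deriv_le_boundary_integral {g K h : ℂ → ℂ} {B : ℝ} {z : ℂ}
    (hg : IsDiscReg g) (hK : IsInner K) (hh : DifferentiableOn ℂ h uDisc)
    (hB : ∀ w ∈ uDisc, ‖h w‖ ≤ B) (hfac : ∀ w ∈ uDisc, g w = K w * h w) (hz : ‖z‖ < 1) (c : ℂ) :
    ‖deriv h z‖ ≤ (1 / (2 * Real.pi)) * ∫ s in (0 : ℝ)..2 * Real.pi,
      ‖g (circleMap 0 1 s) - c‖ / ‖circleMap 0 1 s - z‖ ^ 2 := by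
  obtain ⟨hgd, hgc⟩ := hg
  obtain ⟨hKd, hK1, hKlim⟩ := hK
  have hB0 : 0 ≤ B := (norm_nonneg _).trans (hB 0 (by simp [uDisc]))
  obtain ⟨M, hM⟩ := (isCompact_closedBall (0 : ℂ) 1).exists_bound_of_continuousOn hgc
  set m : ℝ := (1 - ‖z‖) / 2 with hm
  have hm0 : 0 < m := by rw [hm]; linarith
  have hev : ∀ᶠ R : ℝ in 𝓝[<] 1, R ∈ Ioo ((1 + ‖z‖) / 2) 1 :=
    Ioo_mem_nhdsLT (by linarith)
  have hmem : ∀ R ∈ Ioo ((1 + ‖z‖) / 2) 1, ∀ s, circleMap 0 R s ∈ uDisc := by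
    intro R hR s
    have : 0 < R := by linarith [hR.1, norm_nonneg z]
    simp [uDisc, abs_of_pos this, hR.2]
  have hlow : ∀ R ∈ Ioo ((1 + ‖z‖) / 2) 1, ∀ s, m ≤ ‖circleMap 0 R s - z‖ := by
    intro R hR s
    have h0 : 0 < R := by linarith [hR.1, norm_nonneg z]
    have h1 := norm_sub_norm_le (circleMap 0 R s) z
    have h2 : ‖circleMap 0 R s‖ = R := by simp [abs_of_pos h0]
    rw [h2] at h1
    linarith [hR.1]
  have hlim : Tendsto (fun R : ℝ => ∫ s in (0 : ℝ)..2 * Real.pi,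
      R / ‖circleMap 0 R s - z‖ ^ 2 *
        (‖g (circleMap 0 R s) - c‖ + B * (1 - ‖K (circleMap 0 R s)‖ ^ 2))) (𝓝[<] 1)
      (𝓝 (∫ s in (0 : ℝ)..2 * Real.pi,
        1 / ‖circleMap 0 1 s - z‖ ^ 2 * (‖g (circleMap 0 1 s) - c‖ + B * (1 - 1 ^ 2)))) := by
    refine intervalIntegral.tendsto_integral_filter_of_dominated_convergence
      (fun _ => 1 / m ^ 2 * ((M + ‖c‖) + B)) ?_ ?_ intervalIntegrable_const ?_
    · filter_upwards [hev] with R hR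
      have hcm : Continuous (circleMap 0 R) := continuous_circleMap 0 R
      have hgc' : Continuous fun s => g (circleMap 0 R s) :=
        hgd.continuousOn.comp_continuous hcm (hmem R hR)
      have hKc' : Continuous fun s => K (circleMap 0 R s) :=
        hKd.continuousOn.comp_continuous hcm (hmem R hR)
      refine Continuous.aestronglyMeasurable ?_
      refine Continuous.mul (Continuous.div (by fun_prop) (by fun_prop) fun s => ?_)
        ((hgc'.sub continuous_const).norm.add
          (continuous_const.mul (continuous_const.sub (hKc'.norm.pow 2))))
      exact pow_ne_zero _ (hm0.trans_le (hlow R hR s)).ne'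
    · filter_upwards [hev] with R hR
      refine .of_forall fun s _ => ?_
      have h0 : 0 < R := by linarith [hR.1, norm_nonneg z]
      have hζ := hmem R hR s
      have hK' := hK1 _ hζ
      have hg' := hM _ (ball_subset_closedBall hζ)
      have hl := hlow R hR s
      have h2 : 0 ≤ 1 - ‖K (circleMap 0 R s)‖ ^ 2 := by
        nlinarith [norm_nonneg (K (circleMap 0 R s))]
      rw [Real.norm_of_nonneg (by positivity)]
      gcongr
      · exact hR.2.le
      · exact (norm_sub_le _ _).trans (by gcongr)
      · exact mul_le_of_le_one_right hB0 (by linarith [sq_nonneg ‖K (circleMap 0 R s)‖])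
    · filter_upwards [hKlim] with s hs _
      have hcirc : Tendsto (fun R : ℝ => circleMap 0 R s) (𝓝[<] 1) (𝓝 (circleMap 0 1 s)) := by
        have : Continuous fun R : ℝ => circleMap 0 R s := by
          unfold circleMap; fun_prop
        exact (this.tendsto 1).mono_left nhdsWithin_le_nhds
      have hgt : Tendsto (fun R : ℝ => g (circleMap 0 R s)) (𝓝[<] 1) (𝓝 (g (circleMap 0 1 s))) := by
        refine (hgc (circleMap 0 1 s) (by simp)).tendsto.comp
          (tendsto_nhdsWithin_iff.mpr ⟨hcirc, ?_⟩)
        filter_upwards [hev] with R hR using ball_subset_closedBall (hmem R hR s)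
      have hKt : Tendsto (fun R : ℝ => ‖K (circleMap 0 R s)‖) (𝓝[<] 1) (𝓝 1) := by
        simpa only [circleMap_zero] using hs
      have hid : Tendsto (fun R : ℝ => R) (𝓝[<] 1) (𝓝 1) :=
        tendsto_id.mono_left nhdsWithin_le_nhds
      have hne : ‖circleMap 0 1 s - z‖ ^ 2 ≠ 0 := by
        refine pow_ne_zero _ (norm_ne_zero_iff.mpr fun h0 => ?_)
        rw [← sub_eq_zero.mp h0] at hz
        simp at hz
      exact (hid.div ((hcirc.sub_const z).norm.pow 2) hne).mul
        ((hgt.sub_const c).norm.add (((hKt.pow 2).const_sub 1).const_mul B))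
  have hle := ge_of_tendsto (hlim.const_mul (1 / (2 * Real.pi))) (by
    filter_upwards [hev] with R hR
    exact norm_deriv_le_integral_of_factorization hKd hK1 hh hB hgd.continuousOn hfac
      (by linarith [hR.1]) hR.2)
  refine hle.trans_eq ?_
  congr 2
  ext s
  ring

lemma norm_exp_sub_sq (r t θ : ℝ) :
    ‖exp (((t + θ : ℝ) : ℂ) * I) - r * exp ((θ : ℂ) * I)‖ ^ 2 =
      1 - 2 * r * Real.cos t + r ^ 2 := by
  have h1 : exp (((t + θ : ℝ) : ℂ) * I) - r * exp ((θ : ℂ) * I) =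
      exp ((θ : ℂ) * I) * (exp ((t : ℂ) * I) - r) := by
    push_cast
    rw [add_mul, exp_add]
    ring
  rw [h1, norm_mul, norm_exp_ofReal_mul_I, one_mul, ← normSq_eq_norm_sq, normSq_apply]
  simp only [sub_re, sub_im, exp_ofReal_mul_I_re, exp_ofReal_mul_I_im, ofReal_re, ofReal_im]
  nlinarith [Real.sin_sq_add_cos_sq t]

lemma norm_deriv_le_integral_poisson_type {g K h : ℂ → ℂ}
    (hg : IsDiscReg g) (hK : IsInner K) (hh : DifferentiableOn ℂ h uDisc)
    (hB : ∃ B : ℝ, ∀ w ∈ uDisc, ‖h w‖ ≤ B) (hfac : ∀ w ∈ uDisc, g w = K w * h w)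
    (r θ : ℝ) (hr0 : 0 ≤ r) (hr1 : r < 1) :
    ‖deriv h ((r : ℂ) * exp ((θ : ℂ) * I))‖ ≤
      (1 / (2 * Real.pi)) * ∫ t in (-Real.pi)..Real.pi,
        ‖g (exp (((t + θ : ℝ) : ℂ) * I)) - g (exp ((θ : ℂ) * I))‖ /
          (1 - 2 * r * Real.cos t + r ^ 2) := by
  obtain ⟨B, hB⟩ := hB
  have hz : ‖(r : ℂ) * exp ((θ : ℂ) * I)‖ < 1 := by
    rw [norm_mul, norm_exp_ofReal_mul_I, mul_one, norm_real, Real.norm_of_nonneg hr0]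
    exact hr1
  refine (norm_deriv_le_boundary_integral hg hK hh hB hfac hz (g (exp ((θ : ℂ) * I)))).trans_eq ?_
  congr 1
  set F : ℝ → ℝ := fun s => ‖g (circleMap 0 1 s) - g (exp ((θ : ℂ) * I))‖ /
    ‖circleMap 0 1 s - (r : ℂ) * exp ((θ : ℂ) * I)‖ ^ 2 with hF
  have hper : Function.Periodic F (2 * Real.pi) := by
    intro s
    simp only [hF, periodic_circleMap 0 1 s]
  have hshift := hper.intervalIntegral_add_eq 0 (-Real.pi + θ)
  rw [zero_add, show -Real.pi + θ + 2 * Real.pi = Real.pi + θ by ring,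
    ← intervalIntegral.integral_comp_add_right F θ] at hshift
  rw [hshift]
  congr 1
  ext t
  simp only [hF, circleMap_zero, ofReal_one, one_mul]
  rw [norm_exp_sub_sq]

lemma LittleLip.eq_of_order_one {g : ℂ → ℂ} (hg : LittleLip 1 g) {x y : ℂ}
    (hx : x ∈ closedBall (0 : ℂ) 1) (hy : y ∈ closedBall (0 : ℂ) 1) : g x = g y := by
  have hd : ∀ w ∈ closedBall (0 : ℂ) 1,
      HasFDerivWithinAt g (0 : ℂ →L[ℂ] ℂ) (closedBall 0 1) w := by
    intro w hw
    rw [hasFDerivWithinAt_iff_isLittleO, Asymptotics.isLittleO_iff]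
    intro ε hε
    obtain ⟨δ, hδ, hgδ⟩ := hg ε hε
    filter_upwards [self_mem_nhdsWithin, mem_nhdsWithin_of_mem_nhds (ball_mem_nhds w hδ)]
      with u hu huw
    simpa using hgδ u hu w hw (by simpa [dist_eq_norm] using huw)
  have := (convex_closedBall (0 : ℂ) 1).norm_image_sub_le_of_norm_hasFDerivWithin_le (C := 0)
    hd (by simp) hy hx
  simpa [sub_eq_zero] using this

lemma poisson_denom_lower_bound {r t : ℝ} (hr : 1 / 2 ≤ r) (ht : |t| ≤ Real.pi) :
    ((1 - r) ^ 2 + t ^ 2) / 5 ≤ 1 - 2 * r * Real.cos t + r ^ 2 := by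
  have hcos := Real.cos_le_one_sub_mul_cos_sq ht
  have hpi : Real.pi ^ 2 ≤ 10 := by nlinarith [Real.pi_lt_d2, Real.pi_pos]
  have h1 : (1 : ℝ) / 5 ≤ 2 / Real.pi ^ 2 := by
    rw [div_le_div_iff₀ (by norm_num) (by positivity)]
    linarith
  have h2 : 1 / 5 * t ^ 2 ≤ 1 - Real.cos t := by nlinarith [sq_nonneg t]
  nlinarith [sq_nonneg t, sq_nonneg (1 - r)]

lemma rpow_div_sq_add_sq_le {α d x : ℝ} (hα : 0 ≤ α) (hd : 0 < d) (hx : 0 ≤ x) :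
    x ^ α / (d ^ 2 + x ^ 2) ≤ 2 * (d + x) ^ (α - 2) := by
  have h0 : 0 < d + x := by positivity
  rw [Real.rpow_sub h0, Real.rpow_two, mul_div_assoc', div_le_div_iff₀ (by positivity)
    (by positivity)]
  have h1 : x ^ α ≤ (d + x) ^ α := Real.rpow_le_rpow hx (by linarith) hα
  have h2 : (d + x) ^ 2 ≤ 2 * (d ^ 2 + x ^ 2) := by nlinarith [sq_nonneg (d - x)]
  calc x ^ α * (d + x) ^ 2 ≤ (d + x) ^ α * (2 * (d ^ 2 + x ^ 2)) := by gcongr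
    _ = _ := by ring

lemma integral_add_abs_rpow_le {α d a : ℝ} (hα : α < 1) (hd : 0 < d) (ha : 0 ≤ a) :
    ∫ t in (-a)..a, (d + |t|) ^ (α - 2) ≤ 2 * (d ^ (α - 1) / (1 - α)) := by
  have hcont : Continuous fun t : ℝ => (d + |t|) ^ (α - 2) :=
    Continuous.rpow_const (by fun_prop) fun t => Or.inl (by positivity)
  have hpos : ∫ t in (0 : ℝ)..a, (d + |t|) ^ (α - 2) ≤ d ^ (α - 1) / (1 - α) := by
    have h1 : ∫ t in (0 : ℝ)..a, (d + |t|) ^ (α - 2) = ∫ t in (0 : ℝ)..a, (d + t) ^ (α - 2) := by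
      refine intervalIntegral.integral_congr fun t ht => ?_
      rw [uIcc_of_le ha] at ht
      simp only [abs_of_nonneg ht.1]
    rw [h1, intervalIntegral.integral_comp_add_left (fun t : ℝ => t ^ (α - 2)) d, add_zero,
      integral_rpow (Or.inr ⟨by linarith, ?_⟩)]
    · rw [show α - 2 + 1 = -(1 - α) by ring, div_neg, ← neg_div, show α - 1 = -(1 - α) by ring]
      have : 0 < 1 - α := by linarith
      gcongr
      have : 0 ≤ (d + a) ^ (-(1 - α)) := by positivity
      linarith
    · rw [uIcc_of_le (by linarith)]
      exact fun h => absurd h.1 (by linarith)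
  have hneg : ∫ t in (-a)..0, (d + |t|) ^ (α - 2) = ∫ t in (0 : ℝ)..a, (d + |t|) ^ (α - 2) := by
    have := intervalIntegral.integral_comp_neg (a := 0) (b := a)
      (fun t : ℝ => (d + |t|) ^ (α - 2))
    simpa using this.symm
  rw [← intervalIntegral.integral_add_adjacent_intervals (hcont.intervalIntegrable _ 0)
    (hcont.intervalIntegrable 0 _), hneg]
  linarith

lemma norm_exp_add_sub_exp_le (t θ : ℝ) :
    ‖exp (((t + θ : ℝ) : ℂ) * I) - exp ((θ : ℂ) * I)‖ ≤ |t| := by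
  have h1 : exp (((t + θ : ℝ) : ℂ) * I) - exp ((θ : ℂ) * I) =
      exp ((θ : ℂ) * I) * (exp (I * t) - 1) := by
    push_cast
    rw [add_mul, exp_add, mul_comm I]
    ring
  rw [h1, norm_mul, norm_exp_ofReal_mul_I, one_mul]
  exact Real.norm_exp_I_mul_ofReal_sub_one_le

/-- For `α < 1`, the little-o condition makes the Poisson-type integral
`o((1 - r) ^ (α - 1))`, up to an explicit bounded error. -/
lemma integral_poisson_type_le {α η : ℝ} {g : ℂ → ℂ} (hα0 : 0 < α) (hα1 : α < 1)
    (hgc : ContinuousOn g (closedBall 0 1)) (hlip : LittleLip α g) (hη : 0 < η) :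
    ∃ C : ℝ, ∀ r θ : ℝ, 1 / 2 ≤ r → r < 1 →
      ∫ t in (-Real.pi)..Real.pi,
        ‖g (exp (((t + θ : ℝ) : ℂ) * I)) - g (exp ((θ : ℂ) * I))‖ /
          (1 - 2 * r * Real.cos t + r ^ 2) ≤
        20 * η / (1 - α) * (1 - r) ^ (α - 1) + C := by
  obtain ⟨M, hM⟩ := (isCompact_closedBall (0 : ℂ) 1).exists_bound_of_continuousOn hgc
  obtain ⟨δ, hδ, hgδ⟩ := hlip η hη
  have hM0 : 0 ≤ M := (norm_nonneg _).trans (hM 0 (by simp))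
  have hpi := Real.pi_pos
  refine ⟨2 * Real.pi * (10 * M / δ ^ 2), fun r θ hr hr1 => ?_⟩
  have hd : 0 < 1 - r := by linarith
  have hmem : ∀ s : ℝ, exp ((s : ℂ) * I) ∈ closedBall (0 : ℂ) 1 := fun s => by
    simp [norm_exp_ofReal_mul_I]
  have hnum : ∀ t : ℝ, ‖g (exp (((t + θ : ℝ) : ℂ) * I)) - g (exp ((θ : ℂ) * I))‖ ≤
      η * |t| ^ α + 2 * M / δ ^ 2 * t ^ 2 := by
    intro t
    have ht := norm_exp_add_sub_exp_le t θ
    rcases lt_or_ge (‖exp (((t + θ : ℝ) : ℂ) * I) - exp ((θ : ℂ) * I)‖) δ with hlt | hge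
    · have h1 := hgδ _ (hmem (t + θ)) _ (hmem θ) hlt
      have h2 : 0 ≤ 2 * M / δ ^ 2 * t ^ 2 := by positivity
      have h3 : η * ‖exp (((t + θ : ℝ) : ℂ) * I) - exp ((θ : ℂ) * I)‖ ^ α ≤ η * |t| ^ α := by
        gcongr
      linarith
    · have h1 : ‖g (exp (((t + θ : ℝ) : ℂ) * I)) - g (exp ((θ : ℂ) * I))‖ ≤ 2 * M := by
        refine (norm_sub_le _ _).trans ?_
        linarith [hM _ (hmem (t + θ)), hM _ (hmem θ)]
      have h2 : 0 ≤ η * |t| ^ α := by positivity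
      have h3 : δ ^ 2 ≤ t ^ 2 := by
        rw [← sq_abs t]
        exact pow_le_pow_left₀ hδ.le (hge.trans ht) 2
      have h4 : 2 * M ≤ 2 * M / δ ^ 2 * t ^ 2 := by
        rw [div_mul_eq_mul_div, le_div_iff₀ (by positivity)]
        gcongr
      linarith
  have hpt : ∀ t ∈ Icc (-Real.pi) Real.pi,
      ‖g (exp (((t + θ : ℝ) : ℂ) * I)) - g (exp ((θ : ℂ) * I))‖ /
        (1 - 2 * r * Real.cos t + r ^ 2) ≤
      10 * η * ((1 - r) + |t|) ^ (α - 2) + 10 * M / δ ^ 2 := by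
    intro t ht
    have hS : 0 < (1 - r) ^ 2 + |t| ^ 2 := by positivity
    have h1 := poisson_denom_lower_bound hr (abs_le.mpr ht)
    rw [← sq_abs t] at h1
    have h2 := rpow_div_sq_add_sq_le hα0.le hd (abs_nonneg t)
    have h3 : |t| ^ 2 / ((1 - r) ^ 2 + |t| ^ 2) ≤ 1 := by
      rw [div_le_one hS]
      linarith [sq_nonneg (1 - r)]
    calc _ ≤ (η * |t| ^ α + 2 * M / δ ^ 2 * |t| ^ 2) / (((1 - r) ^ 2 + |t| ^ 2) / 5) := by
          rw [sq_abs t] at h1 ⊢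
          gcongr
          exact hnum t
      _ = 5 * η * (|t| ^ α / ((1 - r) ^ 2 + |t| ^ 2)) +
          10 * M / δ ^ 2 * (|t| ^ 2 / ((1 - r) ^ 2 + |t| ^ 2)) := by
          field_simp
          ring
      _ ≤ 5 * η * (2 * ((1 - r) + |t|) ^ (α - 2)) + 10 * M / δ ^ 2 * 1 := by gcongr
      _ = _ := by ring
  have hcont : Continuous fun t : ℝ => ((1 - r) + |t|) ^ (α - 2) :=
    Continuous.rpow_const (by fun_prop) fun t => Or.inl (by positivity)
  have hgcont : Continuous fun t : ℝ => g (exp (((t + θ : ℝ) : ℂ) * I)) :=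
    hgc.comp_continuous (by fun_prop) fun t => hmem (t + θ)
  have hquotInt : IntervalIntegrable (fun t : ℝ =>
      ‖g (exp (((t + θ : ℝ) : ℂ) * I)) - g (exp ((θ : ℂ) * I))‖ /
        (1 - 2 * r * Real.cos t + r ^ 2)) volume (-Real.pi) Real.pi := by
    refine Continuous.intervalIntegrable
      ((hgcont.sub continuous_const).norm.div (by fun_prop) fun t => ?_) _ _
    nlinarith [Real.cos_le_one t, sq_pos_of_pos hd]
  have hpowInt := hcont.intervalIntegrable (μ := volume) (-Real.pi) Real.pi
  refine (intervalIntegral.integral_mono_on (by linarith) hquotInt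
    ((hpowInt.const_mul _).add intervalIntegrable_const) hpt).trans ?_
  rw [intervalIntegral.integral_add (hpowInt.const_mul _) intervalIntegrable_const,
    intervalIntegral.integral_const_mul, intervalIntegral.integral_const, smul_eq_mul]
  have h5 := integral_add_abs_rpow_le hα1 hd hpi.le
  have h6 : 10 * η * ∫ t in (-Real.pi)..Real.pi, ((1 - r) + |t|) ^ (α - 2) ≤
      10 * η * (2 * ((1 - r) ^ (α - 1) / (1 - α))) := by gcongr
  calc _ ≤ 10 * η * (2 * ((1 - r) ^ (α - 1) / (1 - α))) +
        (Real.pi - -Real.pi) * (10 * M / δ ^ 2) := by gcongr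
    _ = _ := by ring

lemma exists_radius_integral_poisson_type_le {α ε : ℝ} {g : ℂ → ℂ} (hα0 : 0 < α) (hα1 : α ≤ 1)
    (hgc : ContinuousOn g (closedBall 0 1)) (hlip : LittleLip α g) (hε : 0 < ε) :
    ∃ r₀ : ℝ, 0 ≤ r₀ ∧ r₀ < 1 ∧ ∀ r θ : ℝ, r₀ < r → r < 1 →
      (1 / (2 * Real.pi)) * ∫ t in (-Real.pi)..Real.pi,
        ‖g (exp (((t + θ : ℝ) : ℂ) * I)) - g (exp ((θ : ℂ) * I))‖ /
          (1 - 2 * r * Real.cos t + r ^ 2) ≤ ε * (1 - r) ^ (α - 1) := by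
  have hpi := Real.pi_pos
  rcases hα1.eq_or_lt with rfl | hα1
  · refine ⟨0, le_rfl, one_pos, fun r θ _ hr1 => ?_⟩
    have hmem : ∀ s : ℝ, exp ((s : ℂ) * I) ∈ closedBall (0 : ℂ) 1 := fun s => by
      simp [norm_exp_ofReal_mul_I]
    have h1 : ∀ t : ℝ, g (exp (((t + θ : ℝ) : ℂ) * I)) = g (exp ((θ : ℂ) * I)) := fun t =>
      hlip.eq_of_order_one (hmem _) (hmem _)
    simp_rw [h1]
    simp [hε.le]
  · have hη : 0 < ε * (1 - α) / 20 := by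
      have : 0 < 1 - α := by linarith
      positivity
    obtain ⟨C, hC⟩ := integral_poisson_type_le hα0 hα1 hgc hlip hη
    have htop : Tendsto (fun r : ℝ => (1 - r) ^ (α - 1)) (𝓝[<] 1) atTop := by
      have h1 : Tendsto (fun r : ℝ => 1 - r) (𝓝[<] 1) (𝓝[>] 0) := by
        refine tendsto_nhdsWithin_iff.mpr ⟨?_, ?_⟩
        · have : Tendsto (fun r : ℝ => 1 - r) (𝓝 1) (𝓝 (1 - 1)) :=
            tendsto_const_nhds.sub tendsto_id
          rw [sub_self] at this
          exact this.mono_left nhdsWithin_le_nhds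
        · filter_upwards [self_mem_nhdsWithin] with r hr
          exact sub_pos.mpr (mem_Iio.mp hr)
      exact (tendsto_rpow_neg_nhdsGT_zero (by linarith)).comp h1
    have hev := htop.eventually_ge_atTop (C / ε)
    rw [eventually_iff, mem_nhdsLT_iff_exists_Ioo_subset] at hev
    obtain ⟨l, hl, hsub⟩ := hev
    refine ⟨max l (1 / 2), by positivity, max_lt hl (by norm_num), fun r θ hr hr1 => ?_⟩
    have h1 := hC r θ ((le_max_right _ _).trans hr.le) hr1
    have h2 : C / ε ≤ (1 - r) ^ (α - 1) := hsub ⟨(le_max_left _ _).trans_lt hr, hr1⟩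
    rw [div_le_iff₀ hε] at h2
    have h3 : 20 * (ε * (1 - α) / 20) / (1 - α) = ε := by
      have : 1 - α ≠ 0 := by linarith
      field_simp
    rw [h3] at h1
    have h4 : 0 ≤ ε * (1 - r) ^ (α - 1) := by
      have : 0 < 1 - r := by linarith
      positivity
    rw [one_div, inv_mul_le_iff₀ (by positivity)]
    nlinarith [Real.pi_gt_three]

/-- If `K` is an inner divisor of `g` with quotient `h` bounded and
analytic, then `|h'(re^{iθ})| ≤ (1/2π)∫ |g(e^{i(t+θ)}) − g(e^{iθ})|/(1−2r cos t+r²) dt`;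
in particular if `g ∈ lip_α` then `|h'(z)| = o((1−|z|)^{α−1})` uniformly over all inner
divisors of `g`. -/
theorem deriv_quotient_inner_bound (α : ℝ) (hα0 : 0 < α) (hα1 : α ≤ 1)
    (g K h : ℂ → ℂ) (hg : IsDiscReg g) (hK : IsInner K)
    (hh : DifferentiableOn ℂ h uDisc) (hhb : ∃ B : ℝ, ∀ z ∈ uDisc, ‖h z‖ ≤ B)
    (hfac : ∀ z ∈ uDisc, g z = K z * h z) :
    (∀ r θ : ℝ, 0 ≤ r → r < 1 →
      ‖deriv h ((r : ℂ) * Complex.exp ((θ : ℂ) * Complex.I))‖ ≤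
        (1 / (2 * Real.pi)) * ∫ t in (-Real.pi)..Real.pi,
          ‖g (Complex.exp (((t + θ : ℝ) : ℂ) * Complex.I)) -
            g (Complex.exp ((θ : ℂ) * Complex.I))‖ / (1 - 2 * r * Real.cos t + r ^ 2)) ∧
    (LittleLip α g → ∀ ε > 0, ∃ r₀ : ℝ, r₀ < 1 ∧
      ∀ K' h' : ℂ → ℂ, IsInner K' → DifferentiableOn ℂ h' uDisc →
        (∃ B : ℝ, ∀ z ∈ uDisc, ‖h' z‖ ≤ B) → (∀ z ∈ uDisc, g z = K' z * h' z) →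
        ∀ z ∈ uDisc, r₀ < ‖z‖ → ‖deriv h' z‖ ≤ ε * (1 - ‖z‖) ^ (α - 1)) := by
  refine ⟨fun r θ hr0 hr1 => norm_deriv_le_integral_poisson_type hg hK hh hhb hfac r θ hr0 hr1,
    fun hlip ε hε => ?_⟩
  obtain ⟨r₀, -, hr₀, hbound⟩ :=
    exists_radius_integral_poisson_type_le hα0 hα1 hg.2 hlip hε
  refine ⟨r₀, hr₀, fun K' h' hK' hh' hhb' hfac' z hz hrz => ?_⟩
  have hz1 : ‖z‖ < 1 := by simpa [uDisc] using hz
  have hderiv := norm_deriv_le_integral_poisson_type hg hK' hh' hhb' hfac' ‖z‖ (arg z)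
    (norm_nonneg z) hz1
  rw [norm_mul_exp_arg_mul_I] at hderiv
  exact hderiv.trans (hbound ‖z‖ (arg z) hrz hz1)
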